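/- For integers a and b, there exists an infinite binary word w whose gap function is blockwise injective and whose subword complexity satisfies f_w(n) = an + b for all sufficiently large n if and only if either a ≥ 2, or (a = 0 and b ≥ 1). -/

import Mathlib

/-- `u` occurs in `w` starting at position `i` (positions are 1-indexed). -/
def FactorAt (w : ℕ → Fin 2) (i : ℕ) (u : List (Fin 2)) : Prop :=
  u = (List.range u.length).map (fun k => w (i + k))

/-- `u` is a subword (factor) of the infinite word `w`. -/
def IsFactor (w : ℕ → Fin 2) (u : List (Fin 2)) : Prop :=
  ∃ i, 1 ≤ i ∧ FactorAt w i u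

/-- The subword complexity function of `w`. -/
noncomputable def complexity (w : ℕ → Fin 2) (n : ℕ) : ℕ :=
  Set.ncard {u : List (Fin 2) | u.length = n ∧ IsFactor w u}

/-- `G` is the 1-distribution function of `w`: `G 0 = 0` and `G i` is the
position of the `i`-th `1` of `w` (positions 1-indexed). -/
def OneDistrib (w : ℕ → Fin 2) (G : ℕ → ℕ) : Prop :=
  G 0 = 0 ∧ StrictMono G ∧ ∀ p, 1 ≤ p → (w p = 1 ↔ ∃ i, 1 ≤ i ∧ G i = p)

/-- The gap function associated with a 1-distribution function `G`. -/
def gap (G : ℕ → ℕ) (i : ℕ) : ℕ := G i - G (i - 1)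

/-- The gap function is strictly increasing. -/
def GapIncreasing (G : ℕ → ℕ) : Prop :=
  ∀ i, 1 ≤ i → gap G i < gap G (i + 1)

/-- `u` is a right special factor of `w`. -/
def RightSpecial (w : ℕ → Fin 2) (u : List (Fin 2)) : Prop :=
  IsFactor w (u ++ [0]) ∧ IsFactor w (u ++ [1])

/-- A function is blockwise injective (on indices `≥ 1`): equal values at `i < j`
force the function to be constant on `[i, j]`. -/
def BlockwiseInj (h : ℕ → ℕ) : Prop :=
  ∀ i j k, 1 ≤ i → i < j → h i = h j → i ≤ k → k ≤ j → h k = h i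

/-- The word of length `n` with letters `f 0, …, f (n - 1)`. -/
def window (f : ℕ → Fin 2) (n : ℕ) : List (Fin 2) := (List.range n).map f

lemma window_eq_iff {f g : ℕ → Fin 2} {n : ℕ} :
    window f n = window g n ↔ ∀ k < n, f k = g k := by
  simp [window]

lemma length_window (f : ℕ → Fin 2) (n : ℕ) : (window f n).length = n := by
  simp [window]

lemma window_succ (f : ℕ → Fin 2) (n : ℕ) : window f (n + 1) = window f n ++ [f n] := by
  simp [window, List.range_succ]

lemma fin_two_eq_zero {x : Fin 2} (h : x ≠ 1) : x = 0 := by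
  revert x; decide

/-- The set of factors of length `n`. -/
def factors (w : ℕ → Fin 2) (n : ℕ) : Set (List (Fin 2)) :=
  {u | ∃ q, 1 ≤ q ∧ u = window (fun k => w (q + k)) n}

/-- The set of right special factors of length `n`. -/
def rightSpecials (w : ℕ → Fin 2) (n : ℕ) : Set (List (Fin 2)) :=
  {u | (∃ q, 1 ≤ q ∧ u = window (fun k => w (q + k)) n ∧ w (q + n) = 0) ∧
    ∃ q, 1 ≤ q ∧ u = window (fun k => w (q + k)) n ∧ w (q + n) = 1}

lemma complexity_eq_ncard (w : ℕ → Fin 2) (n : ℕ) : complexity w n = (factors w n).ncard := by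
  unfold complexity
  congr 1
  ext u
  constructor
  · rintro ⟨rfl, q, hq, h⟩
    exact ⟨q, hq, h⟩
  · rintro ⟨q, hq, rfl⟩
    refine ⟨length_window _ _, q, hq, ?_⟩
    rw [FactorAt, length_window]
    rfl

lemma factors_finite (w : ℕ → Fin 2) (n : ℕ) : (factors w n).Finite := by
  refine (List.finite_length_eq (Fin 2) n).subset ?_
  rintro u ⟨q, -, rfl⟩
  exact length_window _ _

lemma complexity_pos (w : ℕ → Fin 2) (n : ℕ) : 0 < complexity w n := by
  rw [complexity_eq_ncard, Set.ncard_pos (factors_finite w n)]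
  exact ⟨_, 1, le_rfl, rfl⟩

lemma complexity_succ (w : ℕ → Fin 2) (n : ℕ) :
    complexity w (n + 1) = complexity w n + (rightSpecials w n).ncard := by
  let A : Fin 2 → Set (List (Fin 2)) := fun x =>
    {u | ∃ q, 1 ≤ q ∧ u = window (fun k => w (q + k)) n ∧ w (q + n) = x}
  have hA : ∀ x, (A x).Finite := fun x =>
    (factors_finite w n).subset fun u ⟨q, hq, hu, _⟩ => ⟨q, hq, hu⟩
  have hunion : A 0 ∪ A 1 = factors w n := by
    ext u
    constructor
    · rintro (⟨q, hq, hu, -⟩ | ⟨q, hq, hu, -⟩) <;> exact ⟨q, hq, hu⟩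
    · rintro ⟨q, hq, hu⟩
      by_cases h : w (q + n) = 1
      · exact Or.inr ⟨q, hq, hu, h⟩
      · exact Or.inl ⟨q, hq, hu, fin_two_eq_zero h⟩
  have hinj : ∀ x : Fin 2, Function.Injective fun u : List (Fin 2) => u ++ [x] :=
    fun x u v h => List.append_cancel_right h
  have hsucc : factors w (n + 1) = (fun u => u ++ [0]) '' A 0 ∪ (fun u => u ++ [1]) '' A 1 := by
    ext u
    constructor
    · rintro ⟨q, hq, rfl⟩
      rw [window_succ]
      by_cases h : w (q + n) = 1
      · exact Or.inr ⟨_, ⟨q, hq, rfl, h⟩, by simp [h]⟩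
      · exact Or.inl ⟨_, ⟨q, hq, rfl, fin_two_eq_zero h⟩, by simp [fin_two_eq_zero h]⟩
    · rintro (⟨v, ⟨q, hq, rfl, h⟩, rfl⟩ | ⟨v, ⟨q, hq, rfl, h⟩, rfl⟩) <;>
        exact ⟨q, hq, by simp [window_succ, h]⟩
  have hdisj : Disjoint ((fun u => u ++ [0]) '' A 0) ((fun u => u ++ [1]) '' A 1) := by
    rw [Set.disjoint_left]
    rintro _ ⟨u, -, rfl⟩ ⟨v, -, h⟩
    have := (List.append_inj' h rfl).2
    simp at this
  rw [complexity_eq_ncard, complexity_eq_ncard, hsucc,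
    Set.ncard_union_eq hdisj ((hA 0).image _) ((hA 1).image _),
    Set.ncard_image_of_injective _ (hinj 0), Set.ncard_image_of_injective _ (hinj 1),
    ← Set.ncard_union_add_ncard_inter (A 0) (A 1) (hA 0) (hA 1), hunion]
  rfl

lemma rightSpecials_finite (w : ℕ → Fin 2) (n : ℕ) : (rightSpecials w n).Finite :=
  (factors_finite w n).subset fun _ ⟨⟨q, hq, hu, _⟩, _⟩ => ⟨q, hq, hu⟩

/-- The word consisting of zeros except for a `1` at index `k`. -/
def singleOne (k n : ℕ) : List (Fin 2) := window (fun i => if i = k then 1 else 0) n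

/-- The word `0 ^ n`. -/
def zeros (n : ℕ) : List (Fin 2) := window (fun _ => 0) n

lemma zeros_ne_singleOne {k n : ℕ} (hk : k < n) : zeros n ≠ singleOne k n := by
  intro h
  have := window_eq_iff.1 h k hk
  simp at this

namespace OneDistrib

variable {w : ℕ → Fin 2} {G : ℕ → ℕ}

lemma apply_one (hG : OneDistrib w G) {i : ℕ} (hi : 1 ≤ i) : w (G i) = 1 := by
  have h0 := hG.2.1 (show 0 < i by omega)
  exact (hG.2.2 _ (by omega)).2 ⟨i, hi, rfl⟩

lemma apply_zero (hG : OneDistrib w G) {s p : ℕ} (h₁ : G s < p) (h₂ : p < G (s + 1)) :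
    w p = 0 := by
  refine fin_two_eq_zero fun h => ?_
  obtain ⟨i, -, rfl⟩ := (hG.2.2 p (by omega)).1 h
  have := hG.2.1.lt_iff_lt.1 h₁
  have := hG.2.1.lt_iff_lt.1 h₂
  omega

lemma add_gap (hG : OneDistrib w G) (s : ℕ) : G (s + 1) = G s + gap G (s + 1) := by
  have := hG.2.1 (show s < s + 1 by omega)
  simp only [gap, Nat.add_sub_cancel]
  omega

lemma gap_pos (hG : OneDistrib w G) (s : ℕ) : 0 < gap G (s + 1) := by
  have := hG.2.1 (show s < s + 1 by omega)
  have := hG.add_gap s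
  omega

/-- Consecutive ones in a window correspond to consecutive ones in an equal window. -/
lemma exists_transfer (hG : OneDistrib w G) {p q n s : ℕ} (hp : 1 ≤ p) (hs : 1 ≤ s)
    (h : ∀ k < n, w (p + k) = w (q + k)) (h₁ : q ≤ G s) (h₂ : G (s + 1) < q + n) :
    ∃ r, 1 ≤ r ∧ G r + q = G s + p ∧ G (r + 1) + q = G (s + 1) + p := by
  have hlt := hG.2.1 (show s < s + 1 by omega)
  have e₁ := h (G s - q) (by omega)
  have e₂ := h (G (s + 1) - q) (by omega)
  rw [show q + (G s - q) = G s by omega, hG.apply_one hs] at e₁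
  rw [show q + (G (s + 1) - q) = G (s + 1) by omega, hG.apply_one (by omega)] at e₂
  obtain ⟨r, hr, hr'⟩ := (hG.2.2 _ (by omega)).1 e₁
  obtain ⟨t, ht, ht'⟩ := (hG.2.2 _ (by omega)).1 e₂
  have hrt : r < t := hG.2.1.lt_iff_lt.1 (by omega)
  have hrr := hG.2.1 (show r < r + 1 by omega)
  rcases Nat.lt_or_ge (r + 1) t with hlt' | hge
  · have h3 := hG.2.1 hlt'
    have e₃ := h (G (r + 1) - p) (by omega)
    rw [show p + (G (r + 1) - p) = G (r + 1) by omega, hG.apply_one (by omega),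
      hG.apply_zero (s := s) (by omega) (by omega)] at e₃
    simp at e₃
  · obtain rfl : t = r + 1 := by omega
    exact ⟨r, hr, by omega, by omega⟩

lemma zeros_mem_rightSpecials (hG : OneDistrib w G) {n s : ℕ} (h : n + 1 < gap G (s + 1)) :
    zeros n ∈ rightSpecials w n := by
  have hs := hG.add_gap s
  refine ⟨⟨G s + 1, by omega, ?_, ?_⟩, G (s + 1) - n, by omega, ?_, ?_⟩
  · exact window_eq_iff.2 fun k hk => (hG.apply_zero (s := s) (by omega) (by omega)).symm
  · exact hG.apply_zero (s := s) (by omega) (by omega)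
  · exact window_eq_iff.2 fun k hk => (hG.apply_zero (s := s) (by omega) (by omega)).symm
  · rw [show G (s + 1) - n + n = G (s + 1) by omega]
    exact hG.apply_one (by omega)

lemma singleOne_eq_window (hG : OneDistrib w G) {k n s : ℕ} (hk : k < gap G (s + 1))
    (hn : n ≤ k + gap G (s + 2)) :
    singleOne k n = window (fun i => w (G (s + 1) - k + i)) n := by
  have hs := hG.add_gap s
  have hs' : G (s + 2) = G (s + 1) + gap G (s + 2) := hG.add_gap (s + 1)
  refine window_eq_iff.2 fun i hi => ?_
  rcases lt_trichotomy i k with h | rfl | h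
  · rw [if_neg (by omega)]
    exact (hG.apply_zero (s := s) (by omega) (by omega)).symm
  · rw [if_pos rfl, show G (s + 1) - i + i = G (s + 1) by omega, hG.apply_one (by omega)]
  · rw [if_neg (by omega)]
    exact (hG.apply_zero (s := s + 1) (by omega) (show _ < G (s + 2) by omega)).symm

lemma singleOne_mem_rightSpecials (hG : OneDistrib w G) {k n s r : ℕ}
    (hk : k < gap G (s + 1)) (hn : n = k + gap G (s + 2))
    (hr : k < gap G (r + 1)) (hr' : gap G (s + 2) < gap G (r + 2)) :
    singleOne k n ∈ rightSpecials w n := by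
  have h1 := hG.add_gap s
  have h2 : G (s + 2) = G (s + 1) + gap G (s + 2) := hG.add_gap (s + 1)
  have h3 := hG.add_gap r
  have h4 : G (r + 2) = G (r + 1) + gap G (r + 2) := hG.add_gap (r + 1)
  have h5 : 0 < gap G (s + 2) := hG.gap_pos (s + 1)
  refine ⟨⟨G (r + 1) - k, by omega, hG.singleOne_eq_window hr (by omega), ?_⟩,
    G (s + 1) - k, by omega, hG.singleOne_eq_window hk (by omega), ?_⟩
  · exact hG.apply_zero (s := r + 1) (by omega) (show _ < G (r + 2) by omega)
  · rw [show G (s + 1) - k + n = G (s + 2) by omega]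
    exact hG.apply_one (by omega)

/-- If the gaps are strictly increasing, a right special factor contains at most one `1`. -/
lemma eq_of_mem_rightSpecials (hG : OneDistrib w G)
    (hmono : ∀ i j, 1 ≤ i → i < j → gap G i < gap G j) {n : ℕ} {u : List (Fin 2)}
    (hu : u ∈ rightSpecials w n) :
    u = zeros n ∨ ∃ s, gap G (s + 2) ≤ n ∧ n < gap G (s + 2) + gap G (s + 1) ∧
      u = singleOne (n - gap G (s + 2)) n := by
  obtain ⟨⟨p, hp, hup, hp0⟩, q, hq, huq, hq1⟩ := hu
  have hpq : ∀ k < n, w (p + k) = w (q + k) := window_eq_iff.1 (hup ▸ huq)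
  obtain ⟨t, ht, hGt⟩ := (hG.2.2 _ (by omega)).1 hq1
  obtain ⟨s, rfl⟩ : ∃ s, t = s + 1 := ⟨t - 1, by omega⟩
  rcases Nat.lt_or_ge (G s) q with hlt | hge
  · left
    rw [huq]
    exact window_eq_iff.2 fun k hk => hG.apply_zero (s := s) (by omega) (by omega)
  right
  have hs1 : s ≠ 0 := by
    rintro rfl
    have := hG.1
    omega
  obtain ⟨s, rfl⟩ : ∃ r, s = r + 1 := ⟨s - 1, by omega⟩
  have a1 := hG.add_gap s
  have a2 : G (s + 2) = G (s + 1) + gap G (s + 2) := hG.add_gap (s + 1)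
  have p2 : 0 < gap G (s + 2) := hG.gap_pos (s + 1)
  have hGt' : G (s + 2) = q + n := hGt
  have e₁ := hpq (G (s + 1) - q) (by omega)
  rw [show q + (G (s + 1) - q) = G (s + 1) by omega, hG.apply_one (by omega)] at e₁
  obtain ⟨r, hr, hr'⟩ := (hG.2.2 _ (by omega)).1 e₁
  have a3 := hG.add_gap r
  have p3 := hG.gap_pos r
  have hgap : gap G (s + 2) < gap G (r + 1) := by
    by_contra! hle
    rcases Nat.lt_or_ge (G (r + 1)) (p + n) with h | h
    · have e₂ := hpq (G (r + 1) - p) (by omega)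
      rw [show p + (G (r + 1) - p) = G (r + 1) by omega, hG.apply_one (by omega),
        hG.apply_zero (s := s + 1) (by omega)
          (show _ < G (s + 2) by omega)] at e₂
      simp at e₂
    · have : G (r + 1) = p + n := by omega
      rw [← this, hG.apply_one (by omega)] at hp0
      simp at hp0
  have hsr : s + 1 < r := by
    by_contra! hle
    rcases hle.eq_or_lt with h | h
    · subst h
      exact lt_irrefl _ hgap
    · have := hmono (r + 1) (s + 2) (by omega) (by omega)
      omega
  have hlt : G s < q := by
    by_contra! hle
    have hs0 : 1 ≤ s := by
      by_contra! h0
      obtain rfl : s = 0 := by omega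
      have := hG.1
      omega
    obtain ⟨t, ht, ht1, ht2⟩ := hG.exists_transfer hp hs0 hpq hle (by omega)
    have htr : t + 1 = r := hG.2.1.injective (by omega)
    have a4 := hG.add_gap t
    have := hmono (s + 1) (t + 1) (by omega) (by omega)
    omega
  refine ⟨s, by omega, by omega, ?_⟩
  rw [huq, hG.singleOne_eq_window (s := s) (by omega) (by omega)]
  congr 1
  ext k
  rw [show G (s + 1) - (n - gap G (s + 2)) = q by omega]

lemma rightSpecials_eq (hG : OneDistrib w G)
    (hmono : ∀ i j, 1 ≤ i → i < j → gap G i < gap G j) (n : ℕ) :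
    rightSpecials w n = insert (zeros n) ((fun s => singleOne (n - gap G (s + 2)) n) ''
      {s | gap G (s + 2) ≤ n ∧ n < gap G (s + 2) + gap G (s + 1)}) := by
  ext u
  constructor
  · intro hu
    rcases hG.eq_of_mem_rightSpecials hmono hu with h | ⟨s, h₁, h₂, h₃⟩
    · exact Or.inl h
    · exact Or.inr ⟨s, ⟨h₁, h₂⟩, h₃.symm⟩
  · rintro (rfl | ⟨s, ⟨h₁, h₂⟩, rfl⟩)
    · have hle : ∀ s, s < gap G (s + 1) := by
        intro s
        induction s with
        | zero => exact hG.gap_pos 0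
        | succ s ih =>
          have := hmono (s + 1) (s + 1 + 1) (by omega) (by omega)
          omega
      exact hG.zeros_mem_rightSpecials (s := n + 1) (hle _)
    · exact hG.singleOne_mem_rightSpecials (s := s) (r := s + 1) (by omega) (by omega)
        (by have := hmono (s + 1) (s + 1 + 1) (by omega) (by omega); omega)
        (hmono _ _ (by omega) (by omega))

lemma ncard_rightSpecials (hG : OneDistrib w G)
    (hmono : ∀ i j, 1 ≤ i → i < j → gap G i < gap G j) (n : ℕ)
    (hfin : {s | gap G (s + 2) ≤ n ∧ n < gap G (s + 2) + gap G (s + 1)}.Finite) :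
    (rightSpecials w n).ncard =
      {s | gap G (s + 2) ≤ n ∧ n < gap G (s + 2) + gap G (s + 1)}.ncard + 1 := by
  rw [hG.rightSpecials_eq hmono, Set.ncard_insert_of_notMem _ (hfin.image _),
    Set.InjOn.ncard_image]
  · rintro s ⟨hs, -⟩ t ⟨ht, -⟩ h
    have p1 : 0 < gap G (s + 2) := hG.gap_pos (s + 1)
    have p2 : 0 < gap G (t + 2) := hG.gap_pos (t + 1)
    have h' := window_eq_iff.1 h (n - gap G (s + 2)) (by omega)
    have : n - gap G (s + 2) = n - gap G (t + 2) := by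
      by_contra hne
      simp [hne] at h'
    rcases lt_trichotomy s t with h | h | h
    · have := hmono (s + 2) (t + 2) (by omega) (by omega)
      omega
    · exact h
    · have := hmono (t + 2) (s + 2) (by omega) (by omega)
      omega
  · rintro ⟨s, ⟨hs, -⟩, h⟩
    have p1 : 0 < gap G (s + 2) := hG.gap_pos (s + 1)
    exact zeros_ne_singleOne (by omega) h.symm

/-- Removing the first letter lowers the complexity by one for all large lengths. -/
lemma complexity_eq_tail_add_one (hG : OneDistrib w G)
    (hmono : ∀ i j, 1 ≤ i → i ≤ j → gap G i ≤ gap G j) {i : ℕ} (hi : 1 ≤ i)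
    (hlt : gap G (i + 1) < gap G (i + 2)) {w' : ℕ → Fin 2} (hw' : ∀ p, 1 ≤ p → w' p = w (p + 1))
    {n : ℕ} (hn : G (i + 2) ≤ n) : complexity w n = complexity w' n + 1 := by
  have hins : factors w n = insert (window (fun k => w (1 + k)) n) (factors w' n) := by
    ext u
    constructor
    · rintro ⟨q, hq, rfl⟩
      rcases hq.eq_or_lt with rfl | h
      · exact Or.inl rfl
      · refine Or.inr ⟨q - 1, by omega, window_eq_iff.2 fun k _ => ?_⟩
        rw [hw' _ (by omega)]
        congr 1
        omega
    · rintro (rfl | ⟨q, hq, rfl⟩)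
      · exact ⟨1, le_rfl, rfl⟩
      · refine ⟨q + 1, by omega, window_eq_iff.2 fun k _ => ?_⟩
        rw [hw' _ (by omega)]
        congr 1
        omega
  have hnot : window (fun k => w (1 + k)) n ∉ factors w' n := by
    rintro ⟨p, hp, h⟩
    have h' : ∀ k < n, w (p + 1 + k) = w (1 + k) := by
      intro k hk
      have e : w (1 + k) = w' (p + k) := window_eq_iff.1 h k hk
      rw [e, hw' _ (by omega)]
      congr 1
      omega
    have hpos : 0 < G i := by
      have := hG.2.1 (show 0 < i by omega)
      omega
    have hlt' := hG.2.1 (show i < i + 1 by omega)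
    have hlt'' := hG.2.1 (show i + 1 < i + 2 by omega)
    obtain ⟨r, hr, r1, r2⟩ := hG.exists_transfer (p := p + 1) (q := 1) (by omega) hi h'
      (by omega) (by omega)
    obtain ⟨t, ht, t1, t2⟩ := hG.exists_transfer (p := p + 1) (q := 1) (s := i + 1) (by omega)
      (by omega) h' (by omega) (show G (i + 2) < 1 + n by omega)
    obtain rfl : t = r + 1 := hG.2.1.injective (by omega)
    have a1 := hG.add_gap i
    have a2 := hG.add_gap (i + 1)
    have a3 := hG.add_gap r
    have a4 := hG.add_gap (r + 1)
    simp only [Nat.add_assoc, Nat.reduceAdd] at *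
    rcases lt_trichotomy r i with h | rfl | h
    · have := hmono (r + 2) (i + 1) (by omega) (by omega)
      omega
    · omega
    · have := hmono (i + 2) (r + 1) (by omega) (by omega)
      omega
  rw [complexity_eq_ncard, complexity_eq_ncard, hins,
    Set.ncard_insert_of_notMem hnot (factors_finite w' n)]

lemma cons_one (hG : OneDistrib w G) :
    OneDistrib (fun p => if p = 1 then 1 else w (p - 1))
      (fun i => if i = 0 then 0 else G (i - 1) + 1) := by
  refine ⟨rfl, strictMono_nat_of_lt_succ fun i => ?_, fun p hp => ?_⟩
  · rcases i with _ | i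
    · simp
    · simpa using hG.2.1 (show i < i + 1 by omega)
  · rcases hp.eq_or_lt with rfl | h
    · simp only [if_true, true_iff]
      exact ⟨1, le_rfl, by simp [hG.1]⟩
    · simp only [show p ≠ 1 by omega, if_false]
      rw [hG.2.2 _ (by omega)]
      constructor
      · rintro ⟨i, hi, h'⟩
        exact ⟨i + 1, by omega, by simp; omega⟩
      · rintro ⟨i, hi, h'⟩
        simp only [show i ≠ 0 by omega, if_false] at h'
        refine ⟨i - 1, ?_, by omega⟩
        by_contra! h0
        obtain rfl : i = 1 := by omega
        simp [hG.1] at h'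
        omega

lemma tail_of_one_lt (hG : OneDistrib w G) (h : 1 < G 1) :
    OneDistrib (fun p => w (p + 1)) (fun i => G i - 1) := by
  have hpos : ∀ i, 1 ≤ i → 1 < G i := fun i hi => h.trans_le (hG.2.1.monotone hi)
  refine ⟨by simp [hG.1], strictMono_nat_of_lt_succ fun i => ?_, fun p hp => ?_⟩
  · have := hG.2.1 (show i < i + 1 by omega)
    have := hpos (i + 1) (by omega)
    change G i - 1 < G (i + 1) - 1
    omega
  · change w (p + 1) = 1 ↔ _
    rw [hG.2.2 _ (by omega)]
    refine exists_congr fun i => and_congr_right fun hi => ?_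
    have := hpos i hi
    change G i = p + 1 ↔ G i - 1 = p
    omega

lemma tail_of_eq_one (hG : OneDistrib w G) (h : G 1 = 1) :
    OneDistrib (fun p => w (p + 1)) (fun i => G (i + 1) - 1) := by
  have hpos : ∀ i, 1 ≤ G (i + 1) := fun i =>
    h.symm.le.trans (hG.2.1.monotone (show 1 ≤ i + 1 by omega))
  refine ⟨by simp [h], strictMono_nat_of_lt_succ fun i => ?_, fun p hp => ?_⟩
  · have := hG.2.1 (show i + 1 < i + 1 + 1 by omega)
    have := hpos i
    change G (i + 1) - 1 < G (i + 1 + 1) - 1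
    omega
  · change w (p + 1) = 1 ↔ _
    rw [hG.2.2 _ (by omega)]
    constructor
    · rintro ⟨i, hi, h'⟩
      refine ⟨i - 1, ?_, ?_⟩
      · by_contra! h0
        obtain rfl : i = 1 := by omega
        omega
      · change G (i - 1 + 1) - 1 = p
        rw [show i - 1 + 1 = i by omega]
        omega
    · rintro ⟨i, hi, h' : G (i + 1) - 1 = p⟩
      have := hpos i
      exact ⟨i + 1, by omega, by omega⟩

end OneDistrib

/-- Some word with monotone, not eventually constant gap function has complexity `a * n + b` for
all large `n`. -/
def MonotoneRealizable (a b : ℤ) : Prop :=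
  ∃ (w : ℕ → Fin 2) (G : ℕ → ℕ), OneDistrib w G ∧ (∀ i, 1 ≤ i → gap G i ≤ gap G (i + 1)) ∧
    (∀ M, ∃ i, M ≤ i ∧ gap G i < gap G (i + 1)) ∧
    ∃ N : ℕ, ∀ n : ℕ, N ≤ n → (complexity w n : ℤ) = a * n + b

lemma gap_le_gap {G : ℕ → ℕ} (h : ∀ i, 1 ≤ i → gap G i ≤ gap G (i + 1)) (i j : ℕ) (hi : 1 ≤ i)
    (hij : i ≤ j) : gap G i ≤ gap G j := by
  induction j, hij using Nat.le_induction with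
  | base => exact le_rfl
  | succ j hj ih => exact ih.trans (h j (hi.trans hj))

lemma exists_complexity_eq_tail_add_one {w w' : ℕ → Fin 2} {G : ℕ → ℕ} (hG : OneDistrib w G)
    (hmono : ∀ i, 1 ≤ i → gap G i ≤ gap G (i + 1))
    (hlt : ∀ M, ∃ i, M ≤ i ∧ gap G i < gap G (i + 1)) (hw' : ∀ p, 1 ≤ p → w' p = w (p + 1)) :
    ∃ N, ∀ n, N ≤ n → complexity w n = complexity w' n + 1 := by
  obtain ⟨i, hi, h⟩ := hlt 2
  obtain ⟨i, rfl⟩ : ∃ j, i = j + 1 := ⟨i - 1, by omega⟩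
  exact ⟨G (i + 2), fun n hn =>
    hG.complexity_eq_tail_add_one (gap_le_gap hmono) (i := i) (by omega) h hw' hn⟩

lemma MonotoneRealizable.add_one {a b : ℤ} (h : MonotoneRealizable a b) :
    MonotoneRealizable a (b + 1) := by
  obtain ⟨w, G, hG, hmono, hlt, N, hN⟩ := h
  have hG' := hG.cons_one
  have hgap : ∀ i, 1 ≤ i →
      gap (fun i => if i = 0 then 0 else G (i - 1) + 1) (i + 1) = gap G i := by
    intro i hi
    simp only [gap, Nat.add_sub_cancel, show i + 1 ≠ 0 by omega, show i ≠ 0 by omega, if_false]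
    omega
  have hmono' : ∀ i, 1 ≤ i → gap (fun i => if i = 0 then 0 else G (i - 1) + 1) i ≤
      gap (fun i => if i = 0 then 0 else G (i - 1) + 1) (i + 1) := by
    intro i hi
    rcases hi.eq_or_lt with rfl | h
    · rw [hgap 1 le_rfl]
      simpa [gap, hG.1] using Nat.succ_le_of_lt (hG.gap_pos 0)
    · obtain ⟨i, rfl⟩ : ∃ j, i = j + 1 := ⟨i - 1, by omega⟩
      rw [hgap i (by omega), hgap (i + 1) (by omega)]
      exact hmono i (by omega)
  have hlt' : ∀ M, ∃ i, M ≤ i ∧ gap (fun i => if i = 0 then 0 else G (i - 1) + 1) i <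
      gap (fun i => if i = 0 then 0 else G (i - 1) + 1) (i + 1) := by
    intro M
    obtain ⟨i, hi, h⟩ := hlt (M + 1)
    refine ⟨i + 1, by omega, ?_⟩
    rwa [hgap i (by omega), hgap (i + 1) (by omega)]
  obtain ⟨N', hN'⟩ := exists_complexity_eq_tail_add_one hG' hmono' hlt' (w' := w)
    (fun p hp => by simp [show p ≠ 0 by omega])
  refine ⟨_, _, hG', hmono', hlt', max N N', fun n hn => ?_⟩
  rw [hN' n (by omega)]
  push_cast
  rw [hN n (by omega)]
  ring

lemma MonotoneRealizable.sub_one {a b : ℤ} (h : MonotoneRealizable a b) :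
    MonotoneRealizable a (b - 1) := by
  obtain ⟨w, G, hG, hmono, hlt, N, hN⟩ := h
  obtain ⟨N', hN'⟩ := exists_complexity_eq_tail_add_one hG hmono hlt
    (w' := fun p => w (p + 1)) (fun p hp => rfl)
  have hcomp : ∀ n : ℕ, max N N' ≤ n →
      (complexity (fun p => w (p + 1)) n : ℤ) = a * n + (b - 1) := by
    intro n hn
    have h1 := hN' n (by omega)
    have h2 := hN n (by omega)
    rw [h1] at h2
    push_cast at h2
    linarith
  have h1 := hG.2.1 (show 0 < 1 by omega)
  rcases Nat.lt_or_ge 1 (G 1) with h | h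
  · have hgap : ∀ i, 1 ≤ i → gap (fun i => G i - 1) (i + 1) = gap G (i + 1) := by
      intro i hi
      have := hG.2.1.monotone hi
      simp only [gap, Nat.add_sub_cancel]
      omega
    have hgap1 : gap (fun i => G i - 1) 1 ≤ gap G 1 := by
      simp only [gap, hG.1]
      omega
    refine ⟨_, _, hG.tail_of_one_lt h, fun i hi => ?_, fun M => ?_, _, hcomp⟩
    · rw [hgap i hi]
      rcases hi.eq_or_lt with rfl | h
      · exact hgap1.trans (hmono 1 le_rfl)
      · obtain ⟨i, rfl⟩ : ∃ j, i = j + 1 := ⟨i - 1, by omega⟩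
        rw [hgap i (by omega)]
        exact hmono _ (by omega)
    · obtain ⟨i, hi, h⟩ := hlt (M + 2)
      obtain ⟨i, rfl⟩ : ∃ j, i = j + 1 := ⟨i - 1, by omega⟩
      refine ⟨i + 1, by omega, ?_⟩
      rwa [hgap i (by omega), hgap (i + 1) (by omega)]
  · have hgap : ∀ i, 1 ≤ i → gap (fun i => G (i + 1) - 1) i = gap G (i + 1) := by
      intro i hi
      have := hG.2.1.monotone hi
      simp only [gap, Nat.add_sub_cancel, show i - 1 + 1 = i by omega]
      omega
    refine ⟨_, _, hG.tail_of_eq_one (by omega), fun i hi => ?_, fun M => ?_, _, hcomp⟩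
    · rw [hgap i hi, hgap (i + 1) (by omega)]
      exact hmono _ (by omega)
    · obtain ⟨i, hi, h⟩ := hlt (M + 2)
      obtain ⟨i, rfl⟩ : ∃ j, i = j + 1 := ⟨i - 1, by omega⟩
      refine ⟨i, by omega, ?_⟩
      rwa [hgap i (by omega), hgap (i + 1) (by omega)]

lemma MonotoneRealizable.of_any {a b : ℤ} (h : MonotoneRealizable a b) (b' : ℤ) :
    MonotoneRealizable a b' := by
  induction b' using Int.inductionOn' (b := b) with
  | zero => exact h
  | succ k _ ih => exact ih.add_one
  | pred k _ ih => exact ih.sub_one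

/-- A generalized Fibonacci sequence with
`fibGap c (j + 1 + c) = fibGap c (j + 1) + fibGap c j`. -/
def fibGap (c : ℕ) (j : ℕ) : ℕ :=
  if h : j ≤ c ∨ c = 0 then c + 1 + j else fibGap c (j - c) + fibGap c (j - c - 1)
termination_by j
decreasing_by all_goals omega

lemma fibGap_of_le {c j : ℕ} (h : j ≤ c) : fibGap c j = c + 1 + j := by
  rw [fibGap, dif_pos (Or.inl h)]

lemma fibGap_add {c : ℕ} (hc : 1 ≤ c) (j : ℕ) :
    fibGap c (j + 1 + c) = fibGap c (j + 1) + fibGap c j := by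
  rw [fibGap, dif_neg (by omega)]
  congr 2 <;> omega

lemma fibGap_lt_succ {c : ℕ} (hc : 1 ≤ c) (j : ℕ) : fibGap c j < fibGap c (j + 1) := by
  induction j using Nat.strong_induction_on with
  | _ j ih =>
    rcases lt_trichotomy j c with h | rfl | h
    · rw [fibGap_of_le h.le, fibGap_of_le (by omega)]
      omega
    · have h0 := fibGap_add hc 0
      rw [fibGap_of_le (j := 0 + 1) hc, fibGap_of_le (Nat.zero_le j),
        show 0 + 1 + j = j + 1 by omega] at h0
      rw [h0, fibGap_of_le le_rfl]
      omega
    · obtain ⟨k, rfl⟩ : ∃ k, j = k + 1 + c := ⟨j - c - 1, by omega⟩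
      have h1 := fibGap_add hc k
      have h2 := fibGap_add hc (k + 1)
      have h3 := ih k (by omega)
      have h4 := ih (k + 1) (by omega)
      rw [show k + 1 + c + 1 = k + 1 + 1 + c by omega]
      omega

lemma exists_oneDistrib {H : ℕ → ℕ} (hH : ∀ j, 0 < H j) :
    ∃ (w : ℕ → Fin 2) (G : ℕ → ℕ), OneDistrib w G ∧ ∀ i, gap G (i + 1) = H i := by
  classical
  refine ⟨fun p => if ∃ i, 1 ≤ i ∧ ∑ j ∈ Finset.range i, H j = p then 1 else 0,
    fun i => ∑ j ∈ Finset.range i, H j, ⟨by simp, strictMono_nat_of_lt_succ fun i => ?_,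
      fun p hp => ?_⟩, fun i => ?_⟩
  · rw [Finset.sum_range_succ]
    exact Nat.lt_add_of_pos_right (hH i)
  · simp
  · simp [gap, Finset.sum_range_succ]

lemma exists_monotoneRealizable {c : ℕ} (hc : 1 ≤ c) :
    ∃ b, MonotoneRealizable ((c : ℤ) + 1) b := by
  have hH : StrictMono (fibGap c) := strictMono_nat_of_lt_succ (fibGap_lt_succ hc)
  have hpos : ∀ j, 0 < fibGap c j := fun j => by
    have := hH.monotone (Nat.zero_le j)
    rw [fibGap_of_le (Nat.zero_le c)] at this
    omega
  obtain ⟨w, G, hG, hgap⟩ := exists_oneDistrib hpos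
  have hmono : ∀ i j, 1 ≤ i → i < j → gap G i < gap G j := by
    intro i j hi hij
    obtain ⟨i, rfl⟩ : ∃ k, i = k + 1 := ⟨i - 1, by omega⟩
    obtain ⟨j, rfl⟩ : ∃ k, j = k + 1 := ⟨j - 1, by omega⟩
    rw [hgap, hgap]
    exact hH (by omega)
  have hstep : ∀ n, fibGap c c ≤ n → complexity w (n + 1) = complexity w n + (c + 1) := by
    intro n hn
    have hex : ∃ t, n < fibGap c t := ⟨n + 1, hH.le_apply⟩
    obtain ⟨t, ht⟩ : ∃ t, Nat.find hex = t + 1 := by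
      refine ⟨Nat.find hex - 1, ?_⟩
      have h1 := Nat.find_spec hex
      have : c < Nat.find hex := hH.lt_iff_lt.1 (hn.trans_lt h1)
      omega
    have h1 : n < fibGap c (t + 1) := ht ▸ Nat.find_spec hex
    have h2 : fibGap c t ≤ n := not_lt.1 (Nat.find_min hex (by omega))
    have hct : c ≤ t := by
      have := hH.lt_iff_lt.1 (hn.trans_lt h1)
      omega
    have hset : {s | gap G (s + 2) ≤ n ∧ n < gap G (s + 2) + gap G (s + 1)} =
        (Finset.Ico (t - c) t : Set ℕ) := by
      ext s
      rw [Set.mem_ofPred_eq, hgap (s + 1), hgap s, ← fibGap_add hc, Finset.mem_coe, Finset.mem_Ico]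
      constructor
      · rintro ⟨ha, hb⟩
        have := hH.lt_iff_lt.1 (ha.trans_lt h1)
        have := hH.lt_iff_lt.1 (h2.trans_lt hb)
        omega
      · rintro ⟨ha, hb⟩
        exact ⟨(hH.monotone (by omega)).trans h2, h1.trans_le (hH.monotone (by omega))⟩
    rw [complexity_succ, hG.ncard_rightSpecials hmono n (hset ▸ Finset.finite_toSet _), hset,
      Set.ncard_coe_finset, Nat.card_Ico]
    omega
  refine ⟨(complexity w (fibGap c c) : ℤ) - (c + 1) * fibGap c c, w, G, hG,
    fun i hi => (hmono i (i + 1) hi (by omega)).le,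
    fun M => ⟨M + 1, by omega, hmono _ _ (by omega) (by omega)⟩, fibGap c c, fun n hn => ?_⟩
  induction n, hn using Nat.le_induction with
  | base => ring
  | succ n hn ih =>
    rw [hstep n hn]
    push_cast
    rw [ih]
    ring

lemma blockwiseInj_of_le {G : ℕ → ℕ} (h : ∀ i, 1 ≤ i → gap G i ≤ gap G (i + 1)) :
    BlockwiseInj (gap G) := by
  intro i j k hi _ heq hik hkj
  have h1 := gap_le_gap h i k hi hik
  have h2 := gap_le_gap h k j (hi.trans hik) hkj
  omega

/-- The word with a `1` exactly at the multiples of `b` has complexity `b` for large lengths. -/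
lemma exists_complexity_eq_const {b : ℕ} (hb : 1 ≤ b) :
    ∃ (w : ℕ → Fin 2) (G : ℕ → ℕ), OneDistrib w G ∧ BlockwiseInj (gap G) ∧
      ∀ n, b ≤ n → complexity w n = b := by
  classical
  let w : ℕ → Fin 2 := fun p => if b ∣ p then 1 else 0
  have hw : ∀ p, w p = 1 ↔ b ∣ p := fun p => by simp [w]
  have hper : ∀ p, w (p + b) = w p := fun p => by simp [w]
  refine ⟨w, fun i => b * i, ⟨by simp, strictMono_nat_of_lt_succ fun i => ?_, fun p hp => ?_⟩,
    blockwiseInj_of_le fun i hi => ?_, fun n hn => ?_⟩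
  · simp only [Nat.mul_succ]
    omega
  · rw [hw]
    constructor
    · rintro ⟨i, rfl⟩
      exact ⟨i, Nat.pos_of_mul_pos_left hp, rfl⟩
    · rintro ⟨i, -, rfl⟩
      exact dvd_mul_right b i
  · obtain ⟨i, rfl⟩ : ∃ k, i = k + 1 := ⟨i - 1, by omega⟩
    simp only [gap, Nat.add_sub_cancel, Nat.mul_succ]
    omega
  · have himage : factors w n =
        (fun q => window (fun k => w (q + k)) n) '' (Finset.Icc 1 b : Set ℕ) := by
      ext u
      constructor
      · rintro ⟨q, hq, rfl⟩
        induction q using Nat.strong_induction_on with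
        | _ q ih =>
          rcases Nat.lt_or_ge b q with h | h
          · obtain ⟨q', hq', e⟩ := ih (q - b) (by omega) (by omega)
            refine ⟨q', hq', e.trans (window_eq_iff.2 fun k _ => ?_)⟩
            rw [← hper]
            congr 1
            omega
          · exact ⟨q, by simp; omega, rfl⟩
      · rintro ⟨q, hq, rfl⟩
        exact ⟨q, by simp at hq; omega, rfl⟩
    have hlt : ∀ q q', 1 ≤ q → q' ≤ b → q < q' →
        window (fun k => w (q + k)) n ≠ window (fun k => w (q' + k)) n := by
      intro q q' hq hq' hlt h
      have := window_eq_iff.1 h (b - q') (by omega)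
      rw [show q' + (b - q') = b by omega, (hw b).2 dvd_rfl, hw] at this
      have := Nat.le_of_dvd (by omega) this
      omega
    rw [complexity_eq_ncard, himage, Set.InjOn.ncard_image, Set.ncard_coe_finset]
    · simp
    · intro q hq q' hq' h
      simp only [Finset.coe_Icc, Set.mem_Icc] at hq hq'
      rcases lt_trichotomy q q' with h' | h' | h'
      · exact (hlt q q' hq.1 hq'.2 h' h).elim
      · exact h'
      · exact (hlt q' q hq'.1 hq.2 h' h.symm).elim

lemma exists_complexity_le {w : ℕ → Fin 2} {G : ℕ → ℕ} (hG : OneDistrib w G) {M : ℕ}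
    (hM : ∀ i, M ≤ i → gap G (i + 1) = gap G (M + 1)) : ∃ C, ∀ n, complexity w n ≤ C := by
  have hg := hG.gap_pos M
  have hstep : ∀ i, M ≤ i → G (i + 1) = G i + gap G (M + 1) := fun i hi => by
    rw [← hM i hi]
    exact hG.add_gap i
  have hper : ∀ p, G M < p → w (p + gap G (M + 1)) = w p := by
    intro p hp
    have hiff : w (p + gap G (M + 1)) = 1 ↔ w p = 1 := by
      rw [hG.2.2 _ (by omega), hG.2.2 _ (by omega)]
      constructor
      · rintro ⟨i, hi, h⟩
        have hMi : M + 1 < i := hG.2.1.lt_iff_lt.1 (by have := hstep M le_rfl; omega)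
        have := hstep (i - 1) (by omega)
        rw [show i - 1 + 1 = i by omega] at this
        exact ⟨i - 1, by omega, by omega⟩
      · rintro ⟨i, hi, rfl⟩
        exact ⟨i + 1, by omega, hstep i (hG.2.1.lt_iff_lt.1 hp).le⟩
    by_cases h : w p = 1
    · rw [h, hiff, h]
    · rw [fin_two_eq_zero h, fin_two_eq_zero (mt hiff.1 h)]
  refine ⟨G M + gap G (M + 1) + 1, fun n => ?_⟩
  have hsub : factors w n ⊆ (fun q => window (fun k => w (q + k)) n) ''
      (Finset.range (G M + gap G (M + 1) + 1) : Set ℕ) := by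
    rintro u ⟨q, hq, rfl⟩
    clear hq
    induction q using Nat.strong_induction_on with
    | _ q ih =>
      rcases Nat.lt_or_ge (G M + gap G (M + 1)) q with h | h
      · obtain ⟨q', hq', e⟩ := ih (q - gap G (M + 1)) (by omega)
        refine ⟨q', hq', e.trans (window_eq_iff.2 fun k _ => ?_)⟩
        rw [← hper (q - gap G (M + 1) + k) (by omega)]
        congr 1
        omega
      · exact ⟨q, by simp; omega, rfl⟩
  rw [complexity_eq_ncard]
  refine (Set.ncard_le_ncard hsub (Set.toFinite _)).trans ?_
  refine (Set.ncard_image_le (Set.toFinite _)).trans ?_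
  rw [Set.ncard_coe_finset, Finset.card_range]

lemma BlockwiseInj.eventually_lt_gap {w : ℕ → Fin 2} {G : ℕ → ℕ} (hG : OneDistrib w G)
    (hinj : BlockwiseInj (gap G))
    (hM : ¬ ∃ M, ∀ i, M ≤ i → gap G (i + 1) = gap G (M + 1)) (B : ℕ) :
    ∃ M, ∀ i, M ≤ i → B < gap G (i + 1) := by
  have hne : ∀ g, ∃ M, ∀ i, M ≤ i → gap G (i + 1) ≠ g := by
    intro g
    by_contra! h
    obtain ⟨i, -, hi⟩ := h 0
    refine hM ⟨i, fun k hk => ?_⟩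
    obtain ⟨j, hj, hj'⟩ := h (k + 1)
    exact hinj (i + 1) (j + 1) (k + 1) (by omega) (by omega) (hi.trans hj'.symm) (by omega)
      (by omega)
  induction B with
  | zero => exact ⟨0, fun i _ => hG.gap_pos i⟩
  | succ B ih =>
    obtain ⟨M₁, h₁⟩ := ih
    obtain ⟨M₂, h₂⟩ := hne (B + 1)
    refine ⟨max M₁ M₂, fun i hi => ?_⟩
    have := h₁ i (by omega)
    have := h₂ i (by omega)
    omega

lemma exists_complexity_add_two_le {w : ℕ → Fin 2} {G : ℕ → ℕ} (hG : OneDistrib w G)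
    (hlarge : ∀ B, ∃ M, ∀ i, M ≤ i → B < gap G (i + 1)) (N : ℕ) :
    ∃ n, N ≤ n ∧ complexity w n + 2 ≤ complexity w (n + 1) := by
  obtain ⟨s, hs⟩ := hlarge N
  have h1 : N < gap G (s + 1) := hs s le_rfl
  have h2 : N < gap G (s + 2) := hs (s + 1) (by omega)
  obtain ⟨r, hr⟩ := hlarge (gap G (s + 1) + gap G (s + 2))
  have r1 := hr r le_rfl
  have r2 : _ < gap G (r + 2) := hr (r + 1) (by omega)
  refine ⟨gap G (s + 1) - 1 + gap G (s + 2), by omega, ?_⟩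
  rw [complexity_succ]
  have hz := hG.zeros_mem_rightSpecials (n := gap G (s + 1) - 1 + gap G (s + 2)) (s := r)
    (by omega)
  have hx := hG.singleOne_mem_rightSpecials (k := gap G (s + 1) - 1) (s := s) (r := r)
    (by omega) rfl (by omega) (by omega)
  have hne := zeros_ne_singleOne (k := gap G (s + 1) - 1)
    (n := gap G (s + 1) - 1 + gap G (s + 2)) (by omega)
  have := Set.ncard_le_ncard (Set.pair_subset hz hx) (rightSpecials_finite w _)
  rw [Set.ncard_pair hne] at this
  omega

theorem stmt19 (a b : ℤ) :
    (∃ (w : ℕ → Fin 2) (G : ℕ → ℕ), OneDistrib w G ∧ BlockwiseInj (gap G) ∧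
      ∃ N : ℕ, ∀ n : ℕ, N ≤ n → (complexity w n : ℤ) = a * n + b) ↔
    (2 ≤ a ∨ (a = 0 ∧ 1 ≤ b)) := by
  constructor
  · rintro ⟨w, G, hG, hinj, N, hN⟩
    by_cases hM : ∃ M, ∀ i, M ≤ i → gap G (i + 1) = gap G (M + 1)
    · right
      obtain ⟨M, hM⟩ := hM
      obtain ⟨C, hC⟩ := exists_complexity_le hG hM
      have h1 : ∀ n : ℕ, N ≤ n → 1 ≤ a * n + b := fun n hn => by
        rw [← hN n hn]
        exact_mod_cast complexity_pos w n
      have h2 : ∀ n : ℕ, N ≤ n → a * n + b ≤ C := fun n hn => by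
        rw [← hN n hn]
        exact_mod_cast hC n
      have h3 := h1 N le_rfl
      have h4 := h2 N le_rfl
      have h5 := h1 (N + C) (by omega)
      have h6 := h2 (N + C) (by omega)
      push_cast at h5 h6
      have ha : a = 0 := by
        rcases lt_trichotomy a 0 with h | h | h
        · nlinarith
        · exact h
        · nlinarith
      subst ha
      exact ⟨rfl, by simpa using h3⟩
    · left
      obtain ⟨n, hn, h⟩ := exists_complexity_add_two_le hG
        (hinj.eventually_lt_gap hG hM) N
      have h1 := hN n hn
      have h2 := hN (n + 1) (by omega)
      push_cast at h2
      have h3 : (complexity w n : ℤ) + 2 ≤ complexity w (n + 1) := by exact_mod_cast h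
      rw [h1, h2] at h3
      linarith
  · rintro (ha | ⟨rfl, hb⟩)
    · obtain ⟨c, rfl⟩ : ∃ c : ℕ, a = (c : ℤ) + 1 := ⟨(a - 1).toNat, by omega⟩
      obtain ⟨b', hb'⟩ := exists_monotoneRealizable (c := c) (by omega)
      obtain ⟨w, G, hG, hmono, -, hN⟩ := hb'.of_any b
      exact ⟨w, G, hG, blockwiseInj_of_le hmono, hN⟩
    · lift b to ℕ using by omega
      obtain ⟨w, G, hG, hinj, h⟩ := exists_complexity_eq_const (b := b) (by omega)
      exact ⟨w, G, hG, hinj, b, fun n hn => by simp [h n hn]⟩
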